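/- For every a, b, c, d, x ∈ ℝ and every n ≥ 2, the Askey–Wilson polynomial at q = 0, which equals ψ_n(x|b,c,d,0) - a·ψ_{n-1}(x|b,c,d,0), satisfies: ψ_n(x|b,c,d,0) - a·ψ_{n-1}(x|b,c,d,0) = U_n(x) - (a+b+c+d)·U_{n-1}(x) + (ab+ac+ad+bc+bd+cd)·U_{n-2}(x) - (abc+abd+acd+bcd)·U_{n-3}(x) + abcd·U_{n-4}(x), where U is the ℤ-indexed Chebyshev polynomial of the second kind (so U_{-1} = 0, U_{-2} = -1). -/

import Mathlib

open scoped BigOperators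

/-- The q-Pochhammer symbol `(a;q)_n = ∏_{j=0}^{n-1} (1 - a q^j)`. -/
noncomputable def qPoch (a q : ℝ) (n : ℕ) : ℝ := ∏ j ∈ Finset.range n, (1 - a * q ^ j)

/-- Evaluation of the ℤ-indexed Chebyshev polynomial of the second kind. -/
noncomputable def chebU (x : ℝ) (n : ℤ) : ℝ := (Polynomial.Chebyshev.U ℝ n).eval x

/-- The continuous q-Hermite polynomials `h_n(x|q)`. -/
noncomputable def qHermite (q x : ℝ) : ℕ → ℝ
  | 0 => 1
  | 1 => 2 * x
  | n + 2 => 2 * x * qHermite q x (n + 1) - (1 - q ^ (n + 1)) * qHermite q x n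

/-- The big q-Hermite polynomials `h_n(x|a,q)`. -/
noncomputable def bigQHermite (a q x : ℝ) : ℕ → ℝ
  | 0 => 1
  | 1 => 2 * x - a
  | n + 2 => (2 * x - a * q ^ (n + 1)) * bigQHermite a q x (n + 1)
      - (1 - q ^ (n + 1)) * bigQHermite a q x n

/-- The Al-Salam–Chihara polynomials `Q_n(x|a,b,q)`. -/
noncomputable def alSalamChihara (a b q x : ℝ) : ℕ → ℝ
  | 0 => 1
  | 1 => 2 * x - (a + b)
  | n + 2 => (2 * x - (a + b) * q ^ (n + 1)) * alSalamChihara a b q x (n + 1)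
      - (1 - a * b * q ^ n) * (1 - q ^ (n + 1)) * alSalamChihara a b q x n

/-- The continuous dual q-Hahn polynomials `ψ_n(x|a,b,c,q)`. -/
noncomputable def cdqHahn (a b c q x : ℝ) : ℕ → ℝ
  | 0 => 1
  | 1 => 2 * x - (a + b + c) + a * b * c
  | n + 2 =>
      (2 * x - ((a + b + c) * q ^ (n + 1)
          + a * b * c * q ^ n * (1 - q ^ (n + 1) - q ^ (n + 2))))
        * cdqHahn a b c q x (n + 1)
      - (1 - a * b * q ^ n) * (1 - a * c * q ^ n) * (1 - b * c * q ^ n)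
          * (1 - q ^ (n + 1)) * cdqHahn a b c q x n

theorem chebU_add_two (x : ℝ) (n : ℤ) :
    chebU x (n + 2) = 2 * x * chebU x (n + 1) - chebU x n := by
  simp [chebU, Polynomial.Chebyshev.U_add_two]

theorem cdqHahn_zero_succ (a b c x : ℝ) (n : ℕ) :
    cdqHahn a b c 0 x (n + 1) =
      chebU x ((n : ℤ) + 1) - (a + b + c) * chebU x n
        + (a * b + a * c + b * c) * chebU x ((n : ℤ) - 1)
        - a * b * c * chebU x ((n : ℤ) - 2) := by
  induction n using Nat.twoStepInduction with
  | zero => simp [cdqHahn, chebU]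
  | one =>
    simp [cdqHahn, chebU, Polynomial.Chebyshev.U_two]
    ring
  | more n h₀ h₁ =>
    have hrec : cdqHahn a b c 0 x (n + 2 + 1) =
        2 * x * cdqHahn a b c 0 x (n + 1 + 1) - cdqHahn a b c 0 x (n + 1) := by
      simp [cdqHahn]
    have e₁ := chebU_add_two x (n + 1)
    have e₂ := chebU_add_two x n
    have e₃ := chebU_add_two x (n - 1)
    have e₄ := chebU_add_two x (n - 2)
    rw [hrec, h₀, h₁]
    push_cast
    ring_nf at e₁ e₂ e₃ e₄ ⊢
    rw [e₁, e₂, e₃, e₄]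
    ring

theorem askeyWilson_at_q_zero (a b c d x : ℝ) :
    ∀ n : ℕ, 2 ≤ n →
      cdqHahn b c d 0 x n - a * cdqHahn b c d 0 x (n - 1) =
        chebU x n - (a + b + c + d) * chebU x ((n : ℤ) - 1)
          + (a * b + a * c + a * d + b * c + b * d + c * d) * chebU x ((n : ℤ) - 2)
          - (a * b * c + a * b * d + a * c * d + b * c * d) * chebU x ((n : ℤ) - 3)
          + a * b * c * d * chebU x ((n : ℤ) - 4) := by
  intro n hn
  obtain ⟨m, rfl⟩ := Nat.exists_eq_add_of_le' hn
  rw [show m + 2 - 1 = m + 1 from rfl, cdqHahn_zero_succ b c d x (m + 1),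
    cdqHahn_zero_succ b c d x m]
  push_cast
  ring_nf
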